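/- For every i with 1 ≤ i ≤ k and every j ≥ 0, the matrix (A − λ_i I)^j maps the column space of B_{i,1} into the column space of B_{i,min(j+1, r_i)}; in particular, for 0 ≤ j ≤ r_i − 1, if v = B_{i,1} x for some x ∈ ℂⁿ, then (A − λ_i I)^j v = B_{i,j+1} x. -/

import Mathlib

open Matrix Polynomial

lemma pf_unique (k : ℕ) (lam : Fin k → ℂ) (hlam : Function.Injective lam)
    (r : Fin k → ℕ) (c : ℂ) (d : Fin k → ℕ → ℂ)
    (h : ∀ s : ℂ, (∀ i, s ≠ lam i) →
      c + ∑ i, ∑ j ∈ Finset.Icc 1 (r i), ((s - lam i) ^ j)⁻¹ * d i j = 0)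
    (i : Fin k) : ∀ t m : ℕ, 1 ≤ m → m + t = r i → d i m = 0 := by
  intro t
  induction t using Nat.strong_induction_on with
  | _ t ih =>
  intro m hm hmt
  have hz : ∀ j ∈ Finset.Icc 1 (r i), m < j → d i j = 0 := by
    intro j hj hmj
    rw [Finset.mem_Icc] at hj
    exact ih (r i - j) (by omega) j hj.1 (by omega)
  let f : ℂ → ℂ := fun s => (s - lam i) ^ m *
      (c + ∑ i' ∈ Finset.univ.erase i, ∑ j ∈ Finset.Icc 1 (r i'), ((s - lam i') ^ j)⁻¹ * d i' j)
      + ∑ j ∈ Finset.Icc 1 (r i), (s - lam i) ^ (m - j) * d i j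
  have hne : ∀ i' ∈ Finset.univ.erase i, lam i - lam i' ≠ 0 := by
    intro i' hi' h0
    exact (Finset.mem_erase.mp hi').1 (hlam (sub_eq_zero.mp h0)).symm
  have hcont : ContinuousAt f (lam i) := by
    refine ContinuousAt.add (ContinuousAt.mul (by fun_prop) (ContinuousAt.add (by fun_prop) ?_)) ?_
    · refine tendsto_finsetSum _ fun i' hi' => tendsto_finsetSum _ fun j _ => ?_
      refine ContinuousAt.mul (ContinuousAt.inv₀ (by fun_prop) ?_) (by fun_prop)
      exact pow_ne_zero _ (hne i' hi')
    · fun_prop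
  have hev : ∀ᶠ s in nhdsWithin (lam i) {lam i}ᶜ, f s = ∑ j ∈ Finset.Icc 1 (r i), if m < j then d i j else 0 := by
    have h1 : ∀ᶠ s in nhdsWithin (lam i) {lam i}ᶜ, ∀ i' : Fin k, s ≠ lam i' := by
      rw [Filter.eventually_all]
      intro i'
      by_cases hi : i' = i
      · subst hi; exact self_mem_nhdsWithin
      · exact nhdsWithin_le_nhds (isOpen_ne.mem_nhds (fun h0 => hi (hlam h0).symm))
    filter_upwards [h1] with s hs
    have h2 := h s hs
    rw [← Finset.add_sum_erase _ _ (Finset.mem_univ i)] at h2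
    have hu : s - lam i ≠ 0 := sub_ne_zero.mpr (hs i)
    have h3 : ∑ j ∈ Finset.Icc 1 (r i), (s - lam i) ^ (m - j) * d i j
        = (s - lam i) ^ m * ∑ j ∈ Finset.Icc 1 (r i), ((s - lam i) ^ j)⁻¹ * d i j := by
      rw [Finset.mul_sum]
      refine Finset.sum_congr rfl fun j hj => ?_
      by_cases hmj : m < j
      · rw [hz j hj hmj]; simp
      · rw [pow_sub₀ _ hu (by omega)]; ring
    have h4 : (∑ j ∈ Finset.Icc 1 (r i), if m < j then d i j else 0) = 0 := by
      refine Finset.sum_eq_zero fun j hj => ?_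
      split_ifs with hmj
      · exact hz j hj hmj
      · rfl
    rw [h4]
    simp only [f]
    rw [h3]
    linear_combination (s - lam i) ^ m * h2
  have hlim := (hcont.tendsto.mono_left nhdsWithin_le_nhds).congr' hev
  have heq := tendsto_nhds_unique hlim tendsto_const_nhds
  have h4 : (∑ j ∈ Finset.Icc 1 (r i), if m < j then d i j else 0) = 0 := by
    refine Finset.sum_eq_zero fun j hj => ?_
    split_ifs with hmj
    · exact hz j hj hmj
    · rfl
  rw [h4] at heq
  simp only [f, sub_self] at heq
  rw [zero_pow (by omega), zero_mul, zero_add, Finset.sum_eq_single m] at heq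
  · simpa using heq
  · intro j hj hjm
    rcases lt_or_gt_of_ne hjm with h5 | h5
    · rw [zero_pow (by omega), zero_mul]
    · rw [hz j hj h5, mul_zero]
  · intro h5
    exact absurd (Finset.mem_Icc.mpr ⟨hm, by omega⟩) h5

lemma tele_sum {M : Type*} [AddCommGroup M] (g : ℕ → M) (R : ℕ) :
    ∑ j ∈ Finset.Icc 1 R, g (j - 1) = g 0 - g R + ∑ j ∈ Finset.Icc 1 R, g j := by
  induction R with
  | zero => simp
  | succ R ih =>
    rw [Finset.sum_Icc_succ_top (by omega), Finset.sum_Icc_succ_top (by omega), ih]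
    simp only [Nat.add_sub_cancel]
    abel

lemma step_rel
    (n k : ℕ)
    (A : Matrix (Fin n) (Fin n) ℂ)
    (lam : Fin k → ℂ) (hlam : Function.Injective lam)
    (r : Fin k → ℕ) (hr : ∀ i, 1 ≤ r i)
    (hchar : A.charpoly = ∏ i, (X - C (lam i)) ^ r i)
    (B : Fin k → ℕ → Matrix (Fin n) (Fin n) ℂ)
    (hB : ∀ s : ℂ, (∀ i, s ≠ lam i) →
      (s • (1 : Matrix (Fin n) (Fin n) ℂ) - A)⁻¹
        = ∑ i, ∑ j ∈ Finset.Icc 1 (r i), ((s - lam i) ^ j)⁻¹ • B i j)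
    (i : Fin k) (m : ℕ) (hm : 1 ≤ m) (hmr : m ≤ r i) :
    (A - lam i • (1 : Matrix (Fin n) (Fin n) ℂ)) * B i m
      = if m + 1 ≤ r i then B i (m + 1) else 0 := by
  let B' : Fin k → ℕ → Matrix (Fin n) (Fin n) ℂ := fun i j => if j ≤ r i then B i j else 0
  let D : Fin k → ℕ → Matrix (Fin n) (Fin n) ℂ := fun i j =>
    B' i (j + 1) - (A - lam i • (1 : Matrix (Fin n) (Fin n) ℂ)) * B i j
  have key : ∀ s : ℂ, (∀ i, s ≠ lam i) →
      ((∑ i, B i 1) - 1) + ∑ i, ∑ j ∈ Finset.Icc 1 (r i), ((s - lam i) ^ j)⁻¹ • D i j = 0 := by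
    intro s hs
    have hdet : IsUnit (s • (1 : Matrix (Fin n) (Fin n) ℂ) - A).det := by
      have h1 := A.eval_charpoly s
      rw [hchar, eval_prod] at h1
      have h2 : (Matrix.scalar (Fin n) s) = s • (1 : Matrix (Fin n) (Fin n) ℂ) := by
        rw [Matrix.smul_one_eq_diagonal]; rfl
      rw [h2] at h1
      rw [← h1, isUnit_iff_ne_zero, Finset.prod_ne_zero_iff]
      intro a _
      simp only [eval_pow, eval_sub, eval_X, eval_C]
      exact pow_ne_zero _ (sub_ne_zero.mpr (hs a))
    have h1 := Matrix.mul_nonsing_inv _ hdet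
    rw [hB s hs, Finset.mul_sum] at h1
    have h2 : ∀ a : Fin k, (s • (1 : Matrix (Fin n) (Fin n) ℂ) - A) *
        ∑ j ∈ Finset.Icc 1 (r a), ((s - lam a) ^ j)⁻¹ • B a j
        = B a 1 + ∑ j ∈ Finset.Icc 1 (r a), ((s - lam a) ^ j)⁻¹ • D a j := by
      intro a
      have hu : s - lam a ≠ 0 := sub_ne_zero.mpr (hs a)
      have ht := tele_sum (fun j => ((s - lam a) ^ j)⁻¹ • B' a (j + 1)) (r a)
      have hB0 : B' a (r a + 1) = 0 := by simp [B']
      have hB1 : B' a (0 + 1) = B a 1 := by simp [B', hr a]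
      simp only [hB0, hB1, smul_zero, sub_zero, pow_zero, inv_one, one_smul] at ht
      simp only [D, smul_sub, Finset.sum_sub_distrib]
      rw [← add_sub_assoc, ← ht, ← Finset.sum_sub_distrib, Finset.mul_sum]
      refine Finset.sum_congr rfl fun j hj => ?_
      rw [Finset.mem_Icc] at hj
      obtain ⟨l, rfl⟩ : ∃ l, j = l + 1 := ⟨j - 1, by omega⟩
      have h3 : B' a (l + 1) = B a (l + 1) := by simp [B', hj.2]
      rw [Nat.add_sub_cancel, h3]
      have h4 : ((s - lam a) ^ l)⁻¹ = ((s - lam a) ^ (l + 1))⁻¹ * (s - lam a) := by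
        field_simp
        ring
      rw [h4, mul_smul, ← smul_sub, Matrix.mul_smul]
      congr 1
      simp only [sub_mul, sub_smul, smul_mul_assoc, one_mul]
      abel
    simp only [h2, Finset.sum_add_distrib] at h1
    rw [← h1]; abel
  have hD : D i m = 0 := by
    ext p q
    refine pf_unique k lam hlam r (((∑ i, B i 1) - 1 : Matrix (Fin n) (Fin n) ℂ) p q)
      (fun i j => D i j p q) ?_ i (r i - m) m hm (by omega)
    intro s hs
    have := congrFun (congrFun (key s hs) p) q
    simpa only [Matrix.add_apply, Matrix.sum_apply, Matrix.smul_apply, smul_eq_mul,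
      Matrix.zero_apply] using this
  exact (sub_eq_zero.mp hD).symm


/-- `(A - lam i I)^j` maps the column space of `B i 1` into the column space of `B i (min (j+1) (r i))`; in particular `(A - lam i I)^j * (B i 1) x = B i (j+1) x` for `j ≤ r i - 1`. -/
theorem power_maps_column_spaces
    (n k : ℕ) (hn : 1 ≤ n)
    (A : Matrix (Fin n) (Fin n) ℂ)
    (lam : Fin k → ℂ) (hlam : Function.Injective lam)
    (r : Fin k → ℕ) (hr : ∀ i, 1 ≤ r i)
    (hsum : ∑ i, r i = n)
    (hchar : A.charpoly = ∏ i, (X - C (lam i)) ^ r i)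
    (B : Fin k → ℕ → Matrix (Fin n) (Fin n) ℂ)
    (hB : ∀ s : ℂ, (∀ i, s ≠ lam i) →
      (s • (1 : Matrix (Fin n) (Fin n) ℂ) - A)⁻¹
        = ∑ i, ∑ j ∈ Finset.Icc 1 (r i), ((s - lam i) ^ j)⁻¹ • B i j)
    :
    ∀ i : Fin k,
      (∀ j : ℕ, ∀ v : Fin n → ℂ, (∃ x : Fin n → ℂ, (B i 1).mulVec x = v) →
        ∃ y : Fin n → ℂ,
          (B i (min (j + 1) (r i))).mulVec y
            = ((A - lam i • (1 : Matrix (Fin n) (Fin n) ℂ)) ^ j).mulVec v) ∧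
      (∀ j : ℕ, j ≤ r i - 1 → ∀ x : Fin n → ℂ,
        ((A - lam i • (1 : Matrix (Fin n) (Fin n) ℂ)) ^ j).mulVec ((B i 1).mulVec x)
          = (B i (j + 1)).mulVec x) := by
  intro i
  have hstep := step_rel n k A lam hlam r hr hchar B hB i
  have hri := hr i
  have hpow : ∀ j : ℕ, j + 1 ≤ r i →
      (A - lam i • (1 : Matrix (Fin n) (Fin n) ℂ)) ^ j * B i 1 = B i (j + 1) := by
    intro j
    induction j with
    | zero => intro _; simp
    | succ j ih =>
      intro hj
      rw [pow_succ', mul_assoc, ih (by omega), hstep (j + 1) (by omega) (by omega), if_pos hj]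
  have hsec : ∀ j : ℕ, j ≤ r i - 1 → ∀ x : Fin n → ℂ,
        ((A - lam i • (1 : Matrix (Fin n) (Fin n) ℂ)) ^ j).mulVec ((B i 1).mulVec x)
          = (B i (j + 1)).mulVec x := by
    intro j hj x
    rw [Matrix.mulVec_mulVec, hpow j (by omega)]
  refine ⟨?_, hsec⟩
  rintro j v ⟨x, rfl⟩
  by_cases hj : j + 1 ≤ r i
  · exact ⟨x, by rw [min_eq_left hj, hsec j (by omega)]⟩
  · refine ⟨0, ?_⟩
    obtain ⟨l, rfl⟩ : ∃ l, j = l + ((r i - 1) + 1) := ⟨j - r i, by omega⟩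
    rw [Matrix.mulVec_mulVec, pow_add, pow_succ', mul_assoc, mul_assoc, hpow (r i - 1) (by omega),
      hstep _ (by omega) (by omega), if_neg (by omega)]
    simp
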